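/- Let f : (0,∞) → ℝ be a lower semi-continuous function with f(1) = 0 that is continuous and strictly convex on (0,∞), twice differentiable at t = 1 with f''(1) > 0, and such that f(0) := lim_{t↓0} f(t) is finite. Then there exist constants α > 0 and ε ∈ (0,1) such that for every pair of probability measures P, Q on Ω₁×⋯×Ω_n (standard Borel spaces) that are both Bayes-nets with respect to a common DAG G, with P absolutely continuous with respect to Q and density satisfying dP/dQ(x) < 1 + ε for all x ∈ Ω, it holds that α·D_f(P,Q) ≤ Σ_{i=1}^n D_f(P_{X_i∪X_{Π_i}}, Q_{X_i∪X_{Π_i}}). -/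

import Mathlib

open MeasureTheory ProbabilityTheory Filter
open scoped ENNReal NNReal

noncomputable section

universe u

/-- Projection of a point of a product space onto the coordinates in `S`. -/
def proj {n : ℕ} {Ω : Fin n → Type*} (S : Finset (Fin n)) (x : ∀ i, Ω i) (i : S) : Ω i := x i

lemma measurable_proj {n : ℕ} {Ω : Fin n → Type*} [∀ i, MeasurableSpace (Ω i)]
    (S : Finset (Fin n)) : Measurable (proj (Ω := Ω) S) :=
  measurable_pi_lambda _ fun _ => measurable_pi_apply _

/-- A finite measure `P` on a product of standard Borel spaces is a Bayes-net with respect to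
the parent structure `par` (for the topological ordering `0 < 1 < ⋯ < n-1`) if, for every `i`,
the `i`-th coordinate is conditionally independent of the tuple of previous coordinates given
the tuple of parent coordinates `par i`. -/
def IsBayesNet {n : ℕ} {Ω : Fin n → Type*} [∀ i, MeasurableSpace (Ω i)]
    [∀ i, StandardBorelSpace (Ω i)] [∀ i, Nonempty (Ω i)]
    (P : Measure (∀ i, Ω i)) [IsFiniteMeasure P] (par : Fin n → Finset (Fin n)) : Prop :=
  ∀ i : Fin n,
    CondIndepFun (MeasurableSpace.comap (proj (par i)) inferInstance)
      ((measurable_proj (par i)).comap_le) (fun x => x i) (proj (Finset.Iio i)) P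

/-- The `f`-divergence `D_f(P,Q) = ∫ f(dP/dQ) dQ` (for `P` absolutely continuous w.r.t. `Q`). -/
def fDiv (f : ℝ → ℝ) {Ω : Type*} [MeasurableSpace Ω] (P Q : Measure Ω) : ℝ :=
  ∫ x, f ((P.rnDeriv Q x).toReal) ∂Q


open InformationTheory Set Topology

section KullbackLeibler

variable {α β β' γ : Type*} [mα : MeasurableSpace α] [mβ : MeasurableSpace β]
  [mβ' : MeasurableSpace β'] [mγ : MeasurableSpace γ]

/-- Adding two conditionally independent coordinates one after the other gives the same law
whichever of them comes first. -/
lemma map_compProd_prodMkRight_swap (μ : Measure γ) [SFinite μ] (κ : Kernel γ β)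
    [IsSFiniteKernel κ] (η : Kernel γ β') [IsSFiniteKernel η] :
    ((μ ⊗ₘ κ) ⊗ₘ η.prodMkRight β).map (fun p ↦ ((p.1.1, p.2), p.1.2)) =
      (μ ⊗ₘ η) ⊗ₘ κ.prodMkRight β' := by
  have hswap : Measurable (fun p : (γ × β) × β' ↦ ((p.1.1, p.2), p.1.2)) := by fun_prop
  refine Measure.ext_of_lintegral _ fun F hF ↦ ?_
  rw [lintegral_map hF hswap, Measure.lintegral_compProd (by fun_prop),
    Measure.lintegral_compProd hF, Measure.lintegral_compProd, Measure.lintegral_compProd]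
  · refine lintegral_congr fun a ↦ ?_
    simp only [Kernel.prodMkRight_apply]
    exact lintegral_lintegral_swap (by fun_prop)
  · exact Measurable.lintegral_kernel_prod_right' hF
  · exact Measurable.lintegral_kernel_prod_right' (hF.comp hswap)

lemma klDiv_compProd_prodMkRight_le (μ : Measure γ) [IsFiniteMeasure μ] (κ η : Kernel γ β)
    [IsMarkovKernel κ] [IsMarkovKernel η] (ξ : Kernel γ β') [IsMarkovKernel ξ] :
    klDiv ((μ ⊗ₘ ξ) ⊗ₘ κ.prodMkRight β') ((μ ⊗ₘ ξ) ⊗ₘ η.prodMkRight β') ≤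
      klDiv (μ ⊗ₘ κ) (μ ⊗ₘ η) := by
  have hswap : Measurable (fun p : (γ × β) × β' ↦ ((p.1.1, p.2), p.1.2)) := by fun_prop
  rw [← map_compProd_prodMkRight_swap _ κ, ← map_compProd_prodMkRight_swap _ η]
  exact (klDiv_map_le _ _ hswap).trans_eq (klDiv_compProd_left _ _ _)

/-- Subadditivity of the Kullback-Leibler divergence for a pair of conditionally independent
random variables. -/
lemma klDiv_map_le_add_of_condIndepFun [StandardBorelSpace α] [StandardBorelSpace β]
    [Nonempty β] [StandardBorelSpace β'] [Nonempty β'] (P Q : Measure α) [IsFiniteMeasure P]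
    [IsFiniteMeasure Q] {X : α → β} {Z : α → β'} {Y : α → γ} (hX : Measurable X)
    (hZ : Measurable Z) (hY : Measurable Y)
    (hP : CondIndepFun (mγ.comap Y) hY.comap_le X Z P)
    (hQ : CondIndepFun (mγ.comap Y) hY.comap_le X Z Q) :
    klDiv (P.map fun a ↦ ((Y a, Z a), X a)) (Q.map fun a ↦ ((Y a, Z a), X a)) ≤
      klDiv (P.map fun a ↦ (Y a, Z a)) (Q.map fun a ↦ (Y a, Z a)) +
        klDiv (P.map fun a ↦ (Y a, X a)) (Q.map fun a ↦ (Y a, X a)) := by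
  have joint (R : Measure α) [IsFiniteMeasure R]
      (hR : CondIndepFun (mγ.comap Y) hY.comap_le X Z R) :
      R.map (fun a ↦ ((Y a, Z a), X a)) =
        R.map (fun a ↦ (Y a, Z a)) ⊗ₘ (condDistrib X Y R).prodMkRight β' :=
    (condDistrib_ae_eq_iff_measure_eq_compProd _ hX.aemeasurable _).1
      ((condIndepFun_iff_condDistrib_prod_ae_eq_prodMkRight hX hZ hY).1 hR.symm)
  rw [joint P hP, joint Q hQ, klDiv_compProd_eq_add]
  gcongr
  rw [← compProd_map_condDistrib hZ.aemeasurable (X := Y) (μ := P)]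
  refine (klDiv_compProd_prodMkRight_le _ _ _ _).trans ?_
  rw [← compProd_map_condDistrib hX.aemeasurable (X := Y) (μ := P),
    ← compProd_map_condDistrib hX.aemeasurable (X := Y) (μ := Q),
    klDiv_compProd_eq_add (P.map Y) (Q.map Y)]
  exact le_add_self

lemma klDiv_map_le_klDiv_map {P Q : Measure α} [IsFiniteMeasure P] [IsFiniteMeasure Q]
    {T : α → β} {U : α → γ} {g : β → γ} (hT : Measurable T) (hg : Measurable g)
    (hU : ∀ a, U a = g (T a)) : klDiv (P.map U) (Q.map U) ≤ klDiv (P.map T) (Q.map T) := by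
  obtain rfl : U = g ∘ T := funext hU
  rw [← Measure.map_map hg hT, ← Measure.map_map hg hT]
  exact klDiv_map_le _ _ hg

end KullbackLeibler

section BayesNet

variable {n : ℕ} {Ω : Fin n → Type*} [∀ i, MeasurableSpace (Ω i)]

variable [∀ i, StandardBorelSpace (Ω i)] [∀ i, Nonempty (Ω i)]

lemma klDiv_map_proj_Iic_le {P Q : Measure (∀ i, Ω i)} [IsFiniteMeasure P] [IsFiniteMeasure Q]
    {par : Fin n → Finset (Fin n)} (hpar : ∀ i, par i ⊆ Finset.Iio i)
    (hP : IsBayesNet P par) (hQ : IsBayesNet Q par) (i : Fin n) :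
    klDiv (P.map (proj (Finset.Iic i))) (Q.map (proj (Finset.Iic i))) ≤
      klDiv (P.map (proj (Finset.Iio i))) (Q.map (proj (Finset.Iio i))) +
        klDiv (P.map (proj (insert i (par i)))) (Q.map (proj (insert i (par i)))) := by
  have hY := measurable_proj (Ω := Ω) (par i)
  have hZ := measurable_proj (Ω := Ω) (Finset.Iio i)
  have hX : Measurable fun x : ∀ j, Ω j ↦ x i := by fun_prop
  calc klDiv (P.map (proj (Finset.Iic i))) (Q.map (proj (Finset.Iic i)))
    _ ≤ klDiv (P.map fun x ↦ ((proj (par i) x, proj (Finset.Iio i) x), x i))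
          (Q.map fun x ↦ ((proj (par i) x, proj (Finset.Iio i) x), x i)) := by
      refine klDiv_map_le_klDiv_map (g := fun p (j : Finset.Iic i) ↦
        if h : (j : Fin n) < i then p.1.2 ⟨j, Finset.mem_Iio.2 h⟩
        else cast (congrArg Ω (((Finset.mem_Iic.1 j.2).lt_or_eq.resolve_left h).symm)) p.2)
        (by fun_prop) ?_ ?_
      · refine measurable_pi_lambda _ fun ⟨j, hj⟩ ↦ ?_
        rcases (Finset.mem_Iic.1 hj).lt_or_eq with h | rfl
        · simp only [h, dite_true]
          fun_prop
        · simp only [lt_irrefl, dite_false, cast_eq]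
          fun_prop
      · intro x
        ext ⟨j, hj⟩
        rcases (Finset.mem_Iic.1 hj).lt_or_eq with h | rfl
        · simp [h, proj]
        · simp [proj]
    _ ≤ klDiv (P.map fun x ↦ (proj (par i) x, proj (Finset.Iio i) x))
          (Q.map fun x ↦ (proj (par i) x, proj (Finset.Iio i) x)) +
        klDiv (P.map fun x ↦ (proj (par i) x, x i)) (Q.map fun x ↦ (proj (par i) x, x i)) :=
      klDiv_map_le_add_of_condIndepFun P Q hX hZ hY (hP i) (hQ i)
    _ ≤ _ := by
      gcongr
      · exact klDiv_map_le_klDiv_map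
          (g := fun z ↦ (fun j : par i ↦ z ⟨j, hpar i j.2⟩, z)) hZ (by fun_prop) fun _ ↦ rfl
      · exact klDiv_map_le_klDiv_map
          (g := fun z ↦ (fun j : par i ↦ z ⟨j, Finset.mem_insert_of_mem j.2⟩,
            z ⟨i, Finset.mem_insert_self i _⟩)) (measurable_proj _) (by fun_prop) fun _ ↦ rfl

/-- Subadditivity of the Kullback-Leibler divergence on Bayes-nets. -/
lemma klDiv_le_sum_of_isBayesNet {P Q : Measure (∀ i, Ω i)} [IsProbabilityMeasure P]
    [IsProbabilityMeasure Q] {par : Fin n → Finset (Fin n)}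
    (hpar : ∀ i, par i ⊆ Finset.Iio i) (hP : IsBayesNet P par) (hQ : IsBayesNet Q par) :
    klDiv P Q ≤ ∑ i : Fin n,
      klDiv (P.map (proj (insert i (par i)))) (Q.map (proj (insert i (par i)))) := by
  set K : Finset (Fin n) → ℝ≥0∞ := fun S ↦ klDiv (P.map (proj S)) (Q.map (proj S)) with hK
  have initial_le (k : ℕ) (hk : k ≤ n) : K {j : Fin n | (j : ℕ) < k} ≤
      ∑ i ∈ ({j : Fin n | (j : ℕ) < k} : Finset (Fin n)), K (insert i (par i)) := by
    induction k with
    | zero =>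
      have : P.map (proj (∅ : Finset (Fin n))) = Q.map (proj ∅) := by
        have := Measure.isProbabilityMeasure_map (μ := P)
          (measurable_proj (Ω := Ω) ∅).aemeasurable
        have := Measure.isProbabilityMeasure_map (μ := Q)
          (measurable_proj (Ω := Ω) ∅).aemeasurable
        ext s
        induction s using Subsingleton.set_cases <;> simp
      simp [hK, this]
    | succ k ih =>
      have hlt : ({j | (j : ℕ) < k} : Finset (Fin n)) = Finset.Iio ⟨k, hk⟩ := by
        ext j; simp [Fin.lt_def]
      have hle : ({j | (j : ℕ) < k + 1} : Finset (Fin n)) = Finset.Iic ⟨k, hk⟩ := by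
        ext j; simp [Fin.le_def]
      have ih := ih (Nat.le_of_succ_le hk)
      rw [hlt] at ih
      rw [hle, ← Finset.Iio_insert, Finset.sum_insert (by simp), Finset.Iio_insert, add_comm]
      exact (klDiv_map_proj_Iic_le hpar hP hQ _).trans (by gcongr)
  calc klDiv P Q
    _ ≤ K Finset.univ := by
      simpa using klDiv_map_le_klDiv_map (P := P) (Q := Q) (U := id)
        (g := fun (z : ∀ i : (Finset.univ : Finset (Fin n)), Ω i) i ↦ z ⟨i, Finset.mem_univ i⟩)
        (measurable_proj Finset.univ) (by fun_prop) fun _ ↦ rfl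
    _ ≤ _ := by simpa using initial_le n le_rfl

end BayesNet

section TangentGap

/-- The gap at `t` between `f` and its tangent line at `1`, where `f 1 = 0` and `d = f' 1`. -/
def tangentGap (f : ℝ → ℝ) (d t : ℝ) : ℝ := f t - d * (t - 1)

variable {f : ℝ → ℝ}

lemma tangentGap_pos {d : ℝ} (hconvex : StrictConvexOn ℝ (Ioi 0) f) (hone : f 1 = 0)
    (hd : HasDerivAt f d 1) {t : ℝ} (ht : 0 < t) (ht1 : t ≠ 1) : 0 < tangentGap f d t := by
  rw [tangentGap, sub_pos]
  rcases ht1.lt_or_gt with h | h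
  · have := hconvex.slope_lt_of_hasDerivAt (mem_Ioi.2 ht) (mem_Ioi.2 one_pos) h hd
    rw [slope_def_field, hone, div_lt_iff₀ (by linarith)] at this
    linarith
  · have := hconvex.lt_slope_of_hasDerivAt (mem_Ioi.2 one_pos) (mem_Ioi.2 ht) h hd
    rw [slope_def_field, hone, lt_div_iff₀ (by linarith)] at this
    linarith

lemma continuousOn_Ici_of_tendsto (hcont : ContinuousOn f (Ioi 0))
    (hzero : Tendsto f (𝓝[>] 0) (𝓝 (f 0))) : ContinuousOn f (Ici 0) := by
  intro t ht
  rcases (mem_Ici.1 ht).eq_or_lt with rfl | h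
  · exact continuousWithinAt_Ioi_iff_Ici.1 hzero
  · exact (hcont.continuousAt (Ioi_mem_nhds h)).continuousWithinAt

lemma tangentGap_zero_pos {d : ℝ} (hconvex : StrictConvexOn ℝ (Ioi 0) f) (hone : f 1 = 0)
    (hd : HasDerivAt f d 1) (hzero : Tendsto f (𝓝[>] 0) (𝓝 (f 0))) :
    0 < tangentGap f d 0 := by
  have hhalf : 0 < tangentGap f d (1 / 2) :=
    tangentGap_pos hconvex hone hd (by norm_num) (by norm_num)
  have hlim : Tendsto (tangentGap f d) (𝓝[>] 0) (𝓝 (tangentGap f d 0)) :=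
    hzero.sub (Continuous.tendsto (by fun_prop : Continuous fun t : ℝ ↦ d * (t - 1)) 0
      |>.mono_left nhdsWithin_le_nhds)
  refine hhalf.trans_le (ge_of_tendsto hlim ?_)
  filter_upwards [Ioo_mem_nhdsGT (show (0 : ℝ) < 1 / 2 by norm_num)] with t ht
  have h1 := hconvex.convexOn.slope_mono_adjacent (x := t) (y := 1 / 2) (z := 1) ht.1
    (mem_Ioi.2 one_pos) ht.2 (by norm_num)
  rw [hone, div_le_div_iff₀ (by linarith [ht.2]) (by norm_num)] at h1
  simp only [tangentGap] at hhalf ⊢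
  nlinarith [ht.1, ht.2]

lemma tendsto_tangentGap_div_klFun {f' : ℝ → ℝ} {c : ℝ} (hone : f 1 = 0)
    (hderiv : ∀ᶠ t in 𝓝 (1 : ℝ), HasDerivAt f (f' t) t) (hderiv2 : HasDerivAt f' c 1) :
    Tendsto (fun t ↦ tangentGap f (f' 1) t / klFun t) (𝓝[≠] 1) (𝓝 c) := by
  have hpos : ∀ᶠ t : ℝ in 𝓝[≠] 1, 0 < t ∧ t ≠ 1 :=
    (eventually_nhdsWithin_of_eventually_nhds (lt_mem_nhds one_pos)).and self_mem_nhdsWithin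
  refine HasDerivAt.lhopital_zero_nhdsNE (f' := fun t ↦ f' t - f' 1) (g' := Real.log)
    ?_ ?_ ?_ ?_ ?_ ?_
  · filter_upwards [eventually_nhdsWithin_of_eventually_nhds hderiv] with t ht
    have hline := ((hasDerivAt_id t).sub_const 1).const_mul (f' 1)
    rw [mul_one] at hline
    exact ht.sub hline
  · filter_upwards [hpos] with t ht using hasDerivAt_klFun ht.1.ne'
  · filter_upwards [hpos] with t ht using
      Real.log_ne_zero_of_pos_of_ne_one ht.1 ht.2
  · have : ContinuousAt (tangentGap f (f' 1)) 1 :=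
      hderiv.self_of_nhds.continuousAt.sub (by fun_prop)
    simpa [tangentGap, hone] using this.tendsto.mono_left nhdsWithin_le_nhds
  · simpa only [klFun_one] using
      (continuous_klFun.tendsto 1).mono_left (nhdsWithin_le_nhds (s := {1}ᶜ))
  · have hlog := (Real.hasDerivAt_log one_ne_zero).tendsto_slope
    have := hderiv2.tendsto_slope.div hlog (by norm_num)
    rw [inv_one, div_one] at this
    refine this.congr' ?_
    filter_upwards [hpos] with t ht
    simp only [Pi.div_apply, slope_def_field, Real.log_one, sub_zero]
    exact div_div_div_cancel_right₀ (sub_ne_zero.2 ht.2) _ _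

lemma exists_mul_klFun_le_tangentGap_le {f' : ℝ → ℝ} {c : ℝ}
    (hconvex : StrictConvexOn ℝ (Ioi 0) f) (hone : f 1 = 0) (hcont : ContinuousOn f (Ioi 0))
    (hderiv : ∀ᶠ t in 𝓝 (1 : ℝ), HasDerivAt f (f' t) t) (hderiv2 : HasDerivAt f' c 1)
    (hc : 0 < c) (hzero : Tendsto f (𝓝[>] 0) (𝓝 (f 0))) (M : ℝ) :
    ∃ A > 0, ∃ B > 0, ∀ t ∈ Icc 0 M,
      A * klFun t ≤ tangentGap f (f' 1) t ∧ tangentGap f (f' 1) t ≤ B * klFun t := by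
  have hd := hderiv.self_of_nhds
  set r := Function.update (fun t ↦ tangentGap f (f' 1) t / klFun t) 1 c with hr
  have hkl {t : ℝ} (ht : 0 ≤ t) (ht1 : t ≠ 1) : 0 < klFun t :=
    (klFun_nonneg ht).lt_of_ne' ((klFun_eq_zero_iff ht).not.2 ht1)
  have hgap : ∀ t ∈ Icc 0 M, tangentGap f (f' 1) t = r t * klFun t := by
    intro t ht
    rcases eq_or_ne t 1 with rfl | ht1
    · simp [tangentGap, hone, klFun_one]
    · rw [hr, Function.update_of_ne ht1, div_mul_cancel₀ _ (hkl ht.1 ht1).ne']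
  have hrpos : ∀ t ∈ Icc 0 M, 0 < r t := by
    intro t ht
    rcases eq_or_ne t 1 with rfl | ht1
    · simpa [hr] using hc
    · rw [hr, Function.update_of_ne ht1]
      refine div_pos ?_ (hkl ht.1 ht1)
      rcases ht.1.eq_or_lt with rfl | h
      · exact tangentGap_zero_pos hconvex hone hd hzero
      · exact tangentGap_pos hconvex hone hd h ht1
  have hrcont : ContinuousOn r (Icc 0 M) := by
    refine continuousOn_update_iff.2 ⟨?_, fun _ ↦ ?_⟩
    · refine ContinuousOn.div ?_ continuous_klFun.continuousOn
        fun t ht ↦ (hkl ht.1.1 ht.2).ne'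
      exact ((continuousOn_Ici_of_tendsto hcont hzero).mono fun t ht ↦ ht.1.1).sub
        (by fun_prop)
    · exact (tendsto_tangentGap_div_klFun hone hderiv hderiv2).mono_left
        (nhdsWithin_mono _ fun t ht ↦ ht.2)
  rcases (Icc (0 : ℝ) M).eq_empty_or_nonempty with hM | hM
  · simpa [hM] using ⟨1, one_pos⟩
  obtain ⟨a, ha, hmin⟩ := isCompact_Icc.exists_isMinOn hM hrcont
  obtain ⟨b, hb, hmax⟩ := isCompact_Icc.exists_isMaxOn hM hrcont
  refine ⟨r a, hrpos a ha, r b, hrpos b hb, fun t ht ↦ ?_⟩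
  rw [hgap t ht]
  exact ⟨mul_le_mul_of_nonneg_right (hmin ht) (klFun_nonneg ht.1),
    mul_le_mul_of_nonneg_right (hmax ht) (klFun_nonneg ht.1)⟩

end TangentGap

section Comparison

variable {α β : Type*} [MeasurableSpace α] [MeasurableSpace β] {P Q : Measure α}
  {f : ℝ → ℝ} {M : ℝ}

lemma integrable_comp_rnDeriv [IsFiniteMeasure Q] (hf : ContinuousOn f (Ici 0))
    (hM : ∀ᵐ x ∂Q, (P.rnDeriv Q x).toReal ≤ M) :
    Integrable (fun x ↦ f (P.rnDeriv Q x).toReal) Q := by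
  have hmeas : AEStronglyMeasurable (fun x ↦ f (P.rnDeriv Q x).toReal) Q := by
    have hmax : Continuous fun t ↦ f (max t 0) :=
      hf.comp_continuous (by fun_prop) fun t ↦ le_max_right t 0
    have := (hmax.measurable.comp (P.measurable_rnDeriv Q).ennreal_toReal).aestronglyMeasurable
      (μ := Q)
    refine this.congr (ae_of_all _ fun x ↦ ?_)
    simp
  obtain ⟨C, hC⟩ := (isCompact_Icc (a := 0) (b := M)).exists_bound_of_continuousOn
    (hf.mono Icc_subset_Ici_self)
  refine Integrable.of_bound hmeas C ?_
  filter_upwards [hM] with x hx using hC _ ⟨ENNReal.toReal_nonneg, hx⟩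

lemma klDiv_ne_top_of_rnDeriv_le [IsFiniteMeasure P] [IsFiniteMeasure Q] (hPQ : P ≪ Q)
    (hM : ∀ᵐ x ∂Q, (P.rnDeriv Q x).toReal ≤ M) : klDiv P Q ≠ ∞ :=
  klDiv_ne_top hPQ ((integrable_klFun_rnDeriv_iff hPQ).1
    (integrable_comp_rnDeriv continuous_klFun.continuousOn hM))

lemma toReal_rnDeriv_map_le [IsFiniteMeasure P] [IsFiniteMeasure Q] (hPQ : P ≪ Q)
    {g : α → β} (hg : Measurable g) (hM : ∀ᵐ x ∂Q, (P.rnDeriv Q x).toReal ≤ M) :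
    ∀ᵐ y ∂Q.map g, ((P.map g).rnDeriv (Q.map g) y).toReal ≤ M := by
  rw [ae_map_iff hg.aemeasurable
    (measurableSet_le ((P.map g).measurable_rnDeriv _).ennreal_toReal measurable_const)]
  have hmono := condExp_mono (m := MeasurableSpace.comap g inferInstance)
    Measure.integrable_toReal_rnDeriv (integrable_const M) hM
  filter_upwards [toReal_rnDeriv_map hPQ hg, hmono] with x hx hx'
  rw [hx]
  rwa [condExp_const hg.comap_le] at hx'

variable [IsProbabilityMeasure P] [IsProbabilityMeasure Q]

lemma integral_tangentGap_rnDeriv (hPQ : P ≪ Q) (hf : ContinuousOn f (Ici 0))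
    (hM : ∀ᵐ x ∂Q, (P.rnDeriv Q x).toReal ≤ M) (d : ℝ) :
    ∫ x, tangentGap f d (P.rnDeriv Q x).toReal ∂Q = fDiv f P Q := by
  have hint := Measure.integrable_toReal_rnDeriv (μ := P) (ν := Q)
  simp only [tangentGap]
  rw [integral_sub (integrable_comp_rnDeriv hf hM)
    (Integrable.const_mul (f := fun x ↦ (P.rnDeriv Q x).toReal - 1)
      (hint.sub (integrable_const 1)) d), integral_const_mul,
    integral_sub hint (integrable_const 1), Measure.integral_toReal_rnDeriv hPQ]
  simp [fDiv]

lemma fDiv_le_mul_toReal_klDiv (hPQ : P ≪ Q) (hf : ContinuousOn f (Ici 0))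
    (hM : ∀ᵐ x ∂Q, (P.rnDeriv Q x).toReal ≤ M) {d B : ℝ}
    (hB : ∀ t ∈ Icc 0 M, tangentGap f d t ≤ B * klFun t) :
    fDiv f P Q ≤ B * (klDiv P Q).toReal := by
  rw [← integral_tangentGap_rnDeriv hPQ hf hM d, toReal_klDiv_eq_integral_klFun hPQ,
    ← integral_const_mul]
  refine integral_mono_ae (integrable_comp_rnDeriv (hf.sub (by fun_prop)) hM)
    ((integrable_comp_rnDeriv continuous_klFun.continuousOn hM).const_mul B) ?_
  filter_upwards [hM] with x hx using hB _ ⟨ENNReal.toReal_nonneg, hx⟩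

lemma mul_toReal_klDiv_le_fDiv (hPQ : P ≪ Q) (hf : ContinuousOn f (Ici 0))
    (hM : ∀ᵐ x ∂Q, (P.rnDeriv Q x).toReal ≤ M) {d A : ℝ}
    (hA : ∀ t ∈ Icc 0 M, A * klFun t ≤ tangentGap f d t) :
    A * (klDiv P Q).toReal ≤ fDiv f P Q := by
  rw [← integral_tangentGap_rnDeriv hPQ hf hM d, toReal_klDiv_eq_integral_klFun hPQ,
    ← integral_const_mul]
  refine integral_mono_ae
    ((integrable_comp_rnDeriv continuous_klFun.continuousOn hM).const_mul A)
    (integrable_comp_rnDeriv (hf.sub (by fun_prop)) hM) ?_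
  filter_upwards [hM] with x hx using hA _ ⟨ENNReal.toReal_nonneg, hx⟩

end Comparison

/-- Local linear subadditivity of `f`-divergences for one-sided close distributions: if `f`
is lower semi-continuous with `f(1) = 0`, continuous and strictly convex on `(0,∞)`, twice
differentiable at `1` with `f''(1) > 0` (witnessed by a derivative `f'` of `f` near `1` with
`(f')'(1) = c > 0`), and `f(0) = lim_{t ↓ 0} f(t)` is finite, then there are constants
`α > 0` and `ε ∈ (0,1)` such that
`α · D_f(P,Q) ≤ ∑ᵢ D_f(P_{Xᵢ∪X_{Πᵢ}}, Q_{Xᵢ∪X_{Πᵢ}})` for all pairs of Bayes-nets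
`P ≪ Q` that are one-sided `ε`-close. -/
theorem fDiv_local_linear_subadditivity_one_sided_close
    (f : ℝ → ℝ)
    (hconvex : StrictConvexOn ℝ (Set.Ioi 0) f)
    (hlsc : LowerSemicontinuousOn f (Set.Ici 0))
    (hone : f 1 = 0)
    (hcont : ContinuousOn f (Set.Ioi 0))
    (f' : ℝ → ℝ) (c : ℝ)
    (hderiv : ∀ᶠ t in nhds (1:ℝ), HasDerivAt f (f' t) t)
    (hderiv2 : HasDerivAt f' c 1) (hc : 0 < c)
    (hzero : Tendsto f (nhdsWithin 0 (Set.Ioi 0)) (nhds (f 0))) :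
    ∃ α > (0:ℝ), ∃ ε ∈ Set.Ioo (0:ℝ) 1,
      ∀ (n : ℕ) (Ω : Fin n → Type u) [∀ i, MeasurableSpace (Ω i)]
        [∀ i, StandardBorelSpace (Ω i)] [∀ i, Nonempty (Ω i)]
        (par : Fin n → Finset (Fin n)), (∀ i, par i ⊆ Finset.Iio i) →
        ∀ (P Q : Measure (∀ i, Ω i)) [IsProbabilityMeasure P] [IsProbabilityMeasure Q],
        IsBayesNet P par → IsBayesNet Q par → P ≪ Q →
        ∀ h : (∀ i, Ω i) → ℝ, Measurable h →
          P = Q.withDensity (fun x => ENNReal.ofReal (h x)) →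
          (∀ x, h x < 1 + ε) →
          α * fDiv f P Q ≤ ∑ i : Fin n,
            fDiv f (P.map (proj (insert i (par i)))) (Q.map (proj (insert i (par i)))) := by

  have hf := continuousOn_Ici_of_tendsto hcont hzero
  obtain ⟨A, hA, B, hB, hAB⟩ := exists_mul_klFun_le_tangentGap_le hconvex hone hcont hderiv
    hderiv2 hc hzero (3 / 2)
  refine ⟨A / B, div_pos hA hB, 1 / 2, by norm_num, ?_⟩
  intro n Ω _ _ _ par hpar P Q _ _ hP hQ hPQ h hh hdens hlt
  have hratio : ∀ᵐ x ∂Q, (P.rnDeriv Q x).toReal ≤ 3 / 2 := by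
    have := Measure.rnDeriv_withDensity Q hh.ennreal_ofReal
    rw [← hdens] at this
    filter_upwards [this] with x hx
    rw [hx, ENNReal.toReal_ofReal']
    exact max_le (by linarith [hlt x]) (by norm_num)
  have hprob (R : Measure (∀ i, Ω i)) [IsProbabilityMeasure R] (S : Finset (Fin n)) :
      IsProbabilityMeasure (R.map (proj S)) :=
    Measure.isProbabilityMeasure_map (measurable_proj S).aemeasurable
  have hac (S : Finset (Fin n)) : P.map (proj S) ≪ Q.map (proj S) :=
    hPQ.map (measurable_proj S)
  have hmarg (S : Finset (Fin n)) := toReal_rnDeriv_map_le hPQ (measurable_proj S) hratio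
  have hfin (S : Finset (Fin n)) : klDiv (P.map (proj S)) (Q.map (proj S)) ≠ ∞ :=
    klDiv_ne_top_of_rnDeriv_le (hac S) (hmarg S)
  calc A / B * fDiv f P Q
    _ ≤ A / B * (B * (klDiv P Q).toReal) := by
      gcongr
      exact fDiv_le_mul_toReal_klDiv hPQ hf hratio fun t ht ↦ (hAB t ht).2
    _ = A * (klDiv P Q).toReal := by field_simp
    _ ≤ A * ∑ i, (klDiv (P.map (proj (insert i (par i))))
          (Q.map (proj (insert i (par i))))).toReal := by
      rw [← ENNReal.toReal_sum fun i _ ↦ hfin _]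
      gcongr
      · exact ENNReal.sum_ne_top.2 fun i _ ↦ hfin _
      · exact klDiv_le_sum_of_isBayesNet hpar hP hQ
    _ ≤ _ := by
      rw [Finset.mul_sum]
      exact Finset.sum_le_sum fun i _ ↦
        mul_toReal_klDiv_le_fDiv (hac _) hf (hmarg _) fun t ht ↦ (hAB t ht).1
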